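/- Let H be a Hilbert space, θ ∈ H, and B, B_1,…,B_n : ℝ → B(H) uniformly bounded families with B(τ)θ and each B_j(τ)θ independent of τ, and all pairwise commutators among the B's and B tending to 0 in norm as the time arguments tend to −∞. Suppose the limits Ψ_n = lim_{τ→−∞} B_1(τ)⋯B_n(τ)θ and Ψ_{n+1} = lim_{τ→−∞} B(τ)B_1(τ)⋯B_n(τ)θ exist. Then the limit a^+(B) Ψ_n := lim_{τ→−∞} B(τ) Ψ_n exists and equals Ψ_{n+1}. (Existence of in-operators on in-states.) -/

import Mathlib

open Filter

/-- If `x τ → y` and `B τ (x τ) → z` along a filter, and the operators `B τ` are uniformly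
bounded, then `B τ y → z`. -/
theorem tendsto_clm_apply_of_bounded {ι 𝕜 E F : Type*} [NontriviallyNormedField 𝕜]
    [SeminormedAddCommGroup E] [NormedSpace 𝕜 E] [SeminormedAddCommGroup F] [NormedSpace 𝕜 F]
    {l : Filter ι} {B : ι → E →L[𝕜] F} {M : ℝ} (hB : ∀ τ, ‖B τ‖ ≤ M)
    {x : ι → E} {y : E} {z : F} (hx : Tendsto x l (nhds y))
    (hBx : Tendsto (fun τ => B τ (x τ)) l (nhds z)) :
    Tendsto (fun τ => B τ y) l (nhds z) := by
  have hdiff : Tendsto (fun τ => B τ (y - x τ)) l (nhds 0) := by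
    refine squeeze_zero_norm (fun τ => (B τ).le_of_opNorm_le (hB τ) _) ?_
    simpa using ((tendsto_const_nhds (x := y)).sub hx).norm.const_mul M
  simpa using hdiff.add hBx

/-- Existence of in-operators on in-states: if
`Ψ_n = lim B_1(τ)⋯B_n(τ)θ` and `Ψ_{n+1} = lim B(τ)B_1(τ)⋯B_n(τ)θ` exist, then
`lim_{τ→−∞} B(τ) Ψ_n` exists and equals `Ψ_{n+1}`. -/
theorem stmt12
    {H : Type*} [NormedAddCommGroup H] [InnerProductSpace ℂ H] [CompleteSpace H]
    (θ : H) (n : ℕ) (B : ℝ → (H →L[ℂ] H)) (Bs : Fin n → ℝ → (H →L[ℂ] H))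
    (M : ℝ) (hboundB : ∀ τ, ‖B τ‖ ≤ M) (hbound : ∀ j τ, ‖Bs j τ‖ ≤ M)
    (hBconst : ∀ τ τ', B τ θ = B τ' θ)
    (hconst : ∀ j τ τ', Bs j τ θ = Bs j τ' θ)
    (hcommB : ∀ j, Tendsto
      (fun p : ℝ × ℝ => ‖B p.1 * Bs j p.2 - Bs j p.2 * B p.1‖)
      (atBot ×ˢ atBot) (nhds 0))
    (hcomm : ∀ i j, i ≠ j → Tendsto
      (fun p : ℝ × ℝ => ‖Bs i p.1 * Bs j p.2 - Bs j p.2 * Bs i p.1‖)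
      (atBot ×ˢ atBot) (nhds 0))
    (Ψn Ψn1 : H)
    (hΨn : Tendsto (fun τ : ℝ => ((List.ofFn fun j => Bs j τ).prod) θ) atBot (nhds Ψn))
    (hΨn1 : Tendsto (fun τ : ℝ => (B τ * (List.ofFn fun j => Bs j τ).prod) θ)
      atBot (nhds Ψn1)) :
    Tendsto (fun τ : ℝ => B τ Ψn) atBot (nhds Ψn1) := by
  exact tendsto_clm_apply_of_bounded hboundB hΨn hΨn1
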